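/- Let u be a convex solution (in the Aleksandrov sense) of det D²u = f with 0 < λ ≤ f ≤ Λ in a convex domain Ω ⊂ ℝⁿ. Fix x ∈ Ω and p ∈ ∂u(x), and let Σ := {y ∈ closure(Ω) : u(y) = u(x) + p·(y − x)} be the contact set of the supporting hyperplane. Then either Σ = {x}, or Σ has no extreme point in the interior Ω. -/

import Mathlib

open Metric Set MeasureTheory
open scoped RealInnerProductSpace ENNReal

/-- The subdifferential of a function `u` on a set `s` at a point `y`. -/
def subDiff {V : Type*} [NormedAddCommGroup V] [InnerProductSpace ℝ V]
    (s : Set V) (u : V → ℝ) (y : V) : Set V :=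
  {p | ∀ x ∈ s, u y + ⟪p, x - y⟫ ≤ u x}

/-- The Monge–Ampère (Aleksandrov) measure of `u` on `s`, evaluated on a set `A`:
the Lebesgue measure of the image of `A ∩ s` under the subdifferential map. -/
noncomputable def maMeasure {n : ℕ} (s : Set (EuclideanSpace ℝ (Fin n)))
    (u : EuclideanSpace ℝ (Fin n) → ℝ) (A : Set (EuclideanSpace ℝ (Fin n))) : ℝ≥0∞ :=
  volume (⋃ x ∈ A ∩ s, subDiff s u x)
abbrev EE (n : ℕ) := EuclideanSpace ℝ (Fin n)

/-- The polar of `S` with respect to the centre `c`. -/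
def polarAt {n : ℕ} (S : Set (EE n)) (c : EE n) : Set (EE n) :=
  {q | ∀ y ∈ S, ⟪q, y - c⟫ ≤ (1 : ℝ)}

lemma isClosed_polarAt {n : ℕ} (S : Set (EE n)) (c : EE n) : IsClosed (polarAt S c) := by
  have : polarAt S c = ⋂ y ∈ S, {q : EE n | ⟪q, y - c⟫ ≤ (1 : ℝ)} := by
    ext q; simp [polarAt]
  rw [this]
  refine isClosed_biInter fun y _ => ?_
  exact isClosed_le (by fun_prop) continuous_const

open scoped Pointwise in
lemma vol_smul {n : ℕ} (r : ℝ) (A : Set (EE n)) :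
    volume (r • A) = ENNReal.ofReal (|r| ^ n) * volume A := by
  rw [Measure.addHaar_smul, finrank_euclideanSpace_fin, abs_pow]

open scoped Pointwise in
/-- If the centre `z` is close to a supporting hyperplane, its polar is huge compared with
the polar at the midpoint of `z` and `y₀`. -/
lemma polar_compare {n : ℕ} (S : Set (EE n)) (z y₀ a c : EE n) (L η : ℝ) (N : ℕ)
    (hz : z ∈ S) (hy₀ : y₀ ∈ S) (hc : c = (1 / 2 : ℝ) • z + (1 / 2 : ℝ) • y₀)
    (haL : ⟪a, z⟫ - ⟪a, y₀⟫ = L) (hL : 0 < L) (hη : 0 < η) (hN : N * (4 * η) ≤ L)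
    (hS : ∀ y ∈ S, ⟪a, y⟫ - ⟪a, z⟫ ≤ η) :
    (N : ℝ≥0∞) * (ENNReal.ofReal ((1 / 4) ^ n) * volume (polarAt S c)) ≤
      volume (polarAt S z) := by
  set P := polarAt S c with hP
  let t : ℕ → EE n := fun k => ((k : ℝ) * (2 / L)) • a
  let A : ℕ → Set (EE n) := fun k => t k +ᵥ ((1 / 4 : ℝ) • P)
  have hvol : ∀ k, volume (A k) = ENNReal.ofReal ((1 / 4) ^ n) * volume P := by
    intro k
    simp only [A, measure_vadd, vol_smul]
    norm_num [abs_of_pos]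
  have hmeas : ∀ k, MeasurableSet (A k) := by
    intro k
    exact (((isClosed_polarAt S c).smul_of_ne_zero (by norm_num)).vadd _).measurableSet
  have hmem : ∀ k q, q ∈ A k → ∃ r ∈ P, q = t k + (1 / 4 : ℝ) • r := by
    rintro k q ⟨_, ⟨r, hr, rfl⟩, rfl⟩
    exact ⟨r, hr, rfl⟩
  have hPz : ∀ r ∈ P, ⟪r, z⟫ - ⟪r, y₀⟫ ≤ 2 ∧ -2 ≤ ⟪r, z⟫ - ⟪r, y₀⟫ := by
    intro r hr
    have h1 := hr z hz
    have h2 := hr y₀ hy₀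
    simp only [hc, inner_sub_right, inner_add_right, inner_smul_right] at h1 h2
    constructor <;> linarith
  have hdisj : ∀ i j : ℕ, i < j → Disjoint (A i) (A j) := by
    intro i j hij
    rw [Set.disjoint_left]
    intro q hqi hqj
    obtain ⟨r, hr, h1⟩ := hmem i q hqi
    obtain ⟨r', hr', h2⟩ := hmem j q hqj
    have h3 : (⟪q, z⟫ : ℝ) - ⟪q, y₀⟫ = i * 2 + 1 / 4 * (⟪r, z⟫ - ⟪r, y₀⟫) := by
      rw [h1]
      simp only [t, inner_add_left, real_inner_smul_left]
      have : (i * (2 / L) * L : ℝ) = i * 2 := by field_simp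
      rw [← this, ← haL]; ring
    have h4 : (⟪q, z⟫ : ℝ) - ⟪q, y₀⟫ = j * 2 + 1 / 4 * (⟪r', z⟫ - ⟪r', y₀⟫) := by
      rw [h2]
      simp only [t, inner_add_left, real_inner_smul_left]
      have : (j * (2 / L) * L : ℝ) = j * 2 := by field_simp
      rw [← this, ← haL]; ring
    have h5 := hPz r hr
    have h6 := hPz r' hr'
    have h7 : (i : ℝ) + 1 ≤ j := by exact_mod_cast hij
    linarith [h5.1, h5.2, h6.1, h6.2]
  have hsub : ∀ k ∈ Finset.range N, A k ⊆ polarAt S z := by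
    intro k hk q hq y hy
    obtain ⟨r, hr, h1⟩ := hmem k q hq
    have h2 := hr y hy
    have h3 := hPz r hr
    have hkN : (k : ℝ) ≤ N := by exact_mod_cast (Finset.mem_range.1 hk).le
    have h4 := hS y hy
    have h5 : (k * (2 / L) : ℝ) * (⟪a, y⟫ - ⟪a, z⟫) ≤ 1 / 2 := by
      have : (k * (2 / L) : ℝ) * (⟪a, y⟫ - ⟪a, z⟫) ≤ (k * (2 / L)) * η := by gcongr
      refine this.trans ?_
      have : (k * (2 / L) * η : ℝ) = (k * (4 * η)) / (2 * L) := by field_simp; ring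
      rw [this, div_le_iff₀ (by positivity)]
      nlinarith
    simp only [hc, inner_sub_right, inner_add_right, inner_smul_right] at h2
    rw [h1]
    simp only [t, inner_add_left, real_inner_smul_left, inner_sub_right]
    linarith [h3.1, h3.2]
  calc (N : ℝ≥0∞) * (ENNReal.ofReal ((1 / 4) ^ n) * volume P)
      = ∑ k ∈ Finset.range N, volume (A k) := by simp [hvol]
    _ = volume (⋃ k ∈ Finset.range N, A k) := by
        rw [measure_biUnion_finset]
        · intro i _ j _ hij
          rcases lt_or_gt_of_ne hij with h | h
          · exact hdisj i j h
          · exact (hdisj j i h).symm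
        · exact fun k _ => hmeas k
    _ ≤ volume (polarAt S z) := measure_mono (Set.iUnion₂_subset hsub)

/-- Extreme points of compact convex sets have small slices. -/
lemma exists_slice {n : ℕ} (K Ω : Set (EE n)) (x₀ : EE n) (hK : IsCompact K) (hKc : Convex ℝ K)
    (hΩ : IsOpen Ω) (hx₀ : x₀ ∈ Set.extremePoints ℝ K) (hx₀Ω : x₀ ∈ Ω) (hne : K ≠ {x₀}) :
    ∃ (a : EE n) (s : ℝ), s < ⟪a, x₀⟫ ∧ (∀ y ∈ K, s ≤ ⟪a, y⟫ → y ∈ Ω) ∧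
      ∃ y₀ ∈ K, ⟪a, y₀⟫ = s := by
  have hx₀K : x₀ ∈ K := hx₀.1
  have hdiff : Convex ℝ (K \ {x₀}) := (hKc.mem_extremePoints_iff_convex_sdiff.1 hx₀).2
  obtain ⟨q, hqK, hqx⟩ : ∃ q ∈ K, q ≠ x₀ := by
    by_contra! h
    exact hne (Set.Subset.antisymm (fun y hy => h y hy) (by simpa using hx₀K))
  have hd : 0 < dist q x₀ := dist_pos.2 hqx
  set U : Set (EE n) := Ω ∩ ball x₀ (dist q x₀) with hU
  have hUo : IsOpen U := hΩ.inter isOpen_ball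
  have hx₀U : x₀ ∈ U := ⟨hx₀Ω, mem_ball_self hd⟩
  have hT : IsCompact (K \ U) := hK.diff hUo
  obtain ⟨C, hC, hCc, hCsub, hTC⟩ : ∃ C : Set (EE n), IsCompact C ∧ Convex ℝ C ∧
      C ⊆ K \ {x₀} ∧ K \ U ⊆ C := by
    refine hT.induction_on (p := fun T => ∃ C : Set (EE n), IsCompact C ∧ Convex ℝ C ∧
      C ⊆ K \ {x₀} ∧ T ⊆ C) ?_ ?_ ?_ ?_
    · exact ⟨∅, isCompact_empty, convex_empty, by simp, by simp⟩
    · rintro s t hst ⟨C, h1, h2, h3, h4⟩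
      exact ⟨C, h1, h2, h3, hst.trans h4⟩
    · rintro s t ⟨C, h1, h2, h3, h4⟩ ⟨D, k1, k2, k3, k4⟩
      rcases C.eq_empty_or_nonempty with rfl | hCn
      · exact ⟨D, k1, k2, k3, Set.union_subset (h4.trans (by simp)) k4⟩
      rcases D.eq_empty_or_nonempty with rfl | hDn
      · exact ⟨C, h1, h2, h3, Set.union_subset h4 (k4.trans (by simp))⟩
      refine ⟨convexJoin ℝ C D, ?_, h2.convexJoin k2, convexJoin_subset h3 k3 hdiff,
        Set.union_subset (h4.trans (subset_convexJoin_left hDn))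
          (k4.trans (subset_convexJoin_right hCn))⟩
      have himg : convexJoin ℝ C D = (fun w : ℝ × EE n × EE n =>
          (1 - w.1) • w.2.1 + w.1 • w.2.2) '' (Set.Icc (0 : ℝ) 1 ×ˢ (C ×ˢ D)) := by
        ext y
        simp only [mem_convexJoin, segment_eq_image, Set.mem_image, Set.mem_prod, Prod.exists]
        constructor
        · rintro ⟨c, hc, d, hd, θ, hθ, rfl⟩
          exact ⟨θ, c, d, ⟨hθ, hc, hd⟩, rfl⟩
        · rintro ⟨θ, c, d, ⟨hθ, hc, hd⟩, rfl⟩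
          exact ⟨c, hc, d, hd, θ, hθ, rfl⟩
      rw [himg]
      exact (isCompact_Icc.prod (h1.prod k1)).image (by fun_prop)
    · intro y hy
      have hyx : y ≠ x₀ := by rintro rfl; exact hy.2 hx₀U
      have hyd : 0 < dist y x₀ := dist_pos.2 hyx
      refine ⟨closedBall y (dist y x₀ / 2) ∩ K, ?_, closedBall y (dist y x₀ / 2) ∩ K, ?_, ?_,
        ?_, subset_rfl⟩
      · refine Filter.inter_mem (mem_nhdsWithin_of_mem_nhds (closedBall_mem_nhds _ (by positivity)))
          (Filter.mem_of_superset self_mem_nhdsWithin Set.sdiff_subset)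
      · exact hK.inter_left isClosed_closedBall
      · exact (convex_closedBall _ _).inter hKc
      · rintro w ⟨hw, hwK⟩
        refine ⟨hwK, ?_⟩
        rintro rfl
        rw [mem_closedBall, dist_comm] at hw
        linarith
  obtain ⟨f, s, hf, hs⟩ := geometric_hahn_banach_closed_point hCc hC.isClosed
    (fun h => (hCsub h).2 rfl : x₀ ∉ C)
  set a := (InnerProductSpace.toDual ℝ (EE n)).symm f with ha
  have haf : ∀ y, (⟪a, y⟫ : ℝ) = f y := fun y => by
    simp [ha]
  refine ⟨a, s, by rwa [haf], ?_, ?_⟩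
  · intro y hy hsy
    by_contra hyΩ
    have := hf y (hTC ⟨hy, fun h => hyΩ h.1⟩)
    rw [haf] at hsy
    linarith
  · have hqC : f q < s := hf q (hTC ⟨hqK, fun h => lt_irrefl _ (mem_ball.1 h.2)⟩)
    have h := hKc.isPreconnected.intermediate_value hqK hx₀K f.continuous.continuousOn
    obtain ⟨y₀, hy₀, h2⟩ := h ⟨hqC.le, hs.le⟩
    exact ⟨y₀, hy₀, by rw [haf, h2]⟩

open scoped Pointwise in
/-- Aleksandrov estimate from above. -/
lemma ma_ge_polar {n : ℕ} (Ω : Set (EE n)) (u : EE n → ℝ) (hΩb : Bornology.IsBounded Ω)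
    (hcvx : ConvexOn ℝ (closure Ω) u) (hcont : ContinuousOn u (closure Ω))
    (b z : EE n) (k h : ℝ) (S : Set (EE n))
    (hS : S = {y ∈ closure Ω | u y - ⟪b, y⟫ - k ≤ 0}) (hSΩ : S ⊆ Ω) (hz : z ∈ S)
    (hh : 0 < h) (hzh : u z - ⟪b, z⟫ - k = -h) :
    ENNReal.ofReal (h ^ n) * volume (polarAt S z) ≤ maMeasure Ω u S := by
  have hcomp : IsCompact (closure Ω) := hΩb.isCompact_closure
  have hzc : z ∈ closure Ω := by rw [hS] at hz; exact hz.1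
  have key : b +ᵥ (h • polarAt S z) ⊆ ⋃ x ∈ S ∩ Ω, subDiff Ω u x := by
    rintro _ ⟨_, ⟨q, hq, rfl⟩, rfl⟩
    simp only [vadd_eq_add]
    set g : EE n → ℝ := fun y => u y - ⟪b + h • q, y⟫ with hg
    have hgc : ContinuousOn g (closure Ω) := by
      apply hcont.sub; fun_prop
    obtain ⟨y₁, hy₁, hmin⟩ := hcomp.exists_isMinOn ⟨z, hzc⟩ hgc
    have hmin' : ∀ y ∈ closure Ω, g y₁ ≤ g y := fun y hy => hmin hy
    have : ∃ y₂ ∈ S, ∀ y ∈ closure Ω, g y₂ ≤ g y := by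
      by_cases hyS : y₁ ∈ S
      · exact ⟨y₁, hyS, hmin'⟩
      by_cases hgz : g z ≤ g y₁
      · exact ⟨z, hz, fun y hy => hgz.trans (hmin' y hy)⟩
      exfalso
      push Not at hgz
      have hvy : 0 < u y₁ - ⟪b, y₁⟫ - k := by
        by_contra! hcon
        exact hyS (by rw [hS]; exact ⟨hy₁, hcon⟩)
      have hconv : Convex ℝ (closure Ω) := hcvx.1
      have hseg : segment ℝ z y₁ ⊆ closure Ω := hconv.segment_subset hzc hy₁
      have hiv := (convex_segment z y₁).isPreconnected.intermediate_value
        (left_mem_segment ℝ z y₁) (right_mem_segment ℝ z y₁)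
        (f := fun y => u y - ⟪b, y⟫ - k)
        (ContinuousOn.sub ((hcont.mono hseg).sub (by fun_prop)) continuousOn_const)
      obtain ⟨y', hy', h0⟩ := hiv (show (0 : ℝ) ∈ _ from ⟨by rw [hzh]; linarith, hvy.le⟩)
      have hy'S : y' ∈ S := by rw [hS]; exact ⟨hseg hy', h0.le⟩
      have hq1 := hq y' hy'S
      simp only at h0
      obtain ⟨α, β, hα, hβ, hαβ, rfl⟩ := hy'
      have hcx := hcvx.2 hzc hy₁ hα hβ hαβ
      have hβ0 : 0 < β := by
        rcases hβ.lt_or_eq with h | h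
        · exact h
        · subst h
          have : α = 1 := by linarith
          subst this
          simp only [one_smul, zero_smul, add_zero] at h0
          linarith
      simp only [hg, inner_add_left, inner_add_right, inner_sub_right, real_inner_smul_left,
        inner_smul_right, smul_eq_mul] at *
      have hα' : α = 1 - β := by linarith
      subst hα'
      nlinarith
    obtain ⟨y₂, hy₂, hm⟩ := this
    refine Set.mem_iUnion₂.2 ⟨y₂, ⟨hy₂, hSΩ hy₂⟩, ?_⟩
    intro y hy
    have := hm y (subset_closure hy)
    simp only [hg] at this
    rw [inner_sub_right]
    linarith
  calc ENNReal.ofReal (h ^ n) * volume (polarAt S z)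
      = volume (b +ᵥ (h • polarAt S z)) := by
        rw [measure_vadd, vol_smul, abs_of_pos hh]
    _ ≤ _ := measure_mono key

open scoped Pointwise in
/-- Aleksandrov estimate from below. -/
lemma ma_le_polar {n : ℕ} (Ω : Set (EE n)) (u : EE n → ℝ)
    (b c : EE n) (k m : ℝ) (S : Set (EE n)) (hSc : Convex ℝ S)
    (hS : ∀ y ∈ S, u y - ⟪b, y⟫ - k ≤ 0) (hSΩ : S ⊆ Ω) 
    (hm : 0 < m) (hSm : ∀ y ∈ S, -m ≤ u y - ⟪b, y⟫ - k) (hc : c ∈ S) :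
    maMeasure Ω u (AffineMap.homothety c (1 / 2 : ℝ) '' S) ≤
      ENNReal.ofReal ((2 * m) ^ n) * volume (polarAt S c) := by
  have key : (⋃ x ∈ (AffineMap.homothety c (1 / 2 : ℝ) '' S) ∩ Ω, subDiff Ω u x) ⊆
      b +ᵥ ((2 * m) • polarAt S c) := by
    refine Set.iUnion₂_subset ?_
    rintro _ ⟨⟨w, hw, rfl⟩, -⟩ q hq
    have hhom : AffineMap.homothety c (1 / 2 : ℝ) w = (1 / 2 : ℝ) • c + (1 / 2 : ℝ) • w := by
      rw [AffineMap.homothety_apply]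
      simp only [vsub_eq_sub, vadd_eq_add]
      module
    rw [hhom] at hq
    have hy : (1 / 2 : ℝ) • c + (1 / 2 : ℝ) • w ∈ S :=
      hSc hc hw (by norm_num) (by norm_num) (by norm_num)
    refine ⟨q - b, ⟨(2 * m)⁻¹ • (q - b), ?_, ?_⟩, ?_⟩
    · intro w' hw'
      have hz : (1 / 2 : ℝ) • w + (1 / 2 : ℝ) • w' ∈ S :=
        hSc hw hw' (by norm_num) (by norm_num) (by norm_num)
      have h1 := hq _ (hSΩ hz)
      have h2 := hS _ hz
      have h3 := hSm _ hy
      rw [real_inner_smul_left, inv_mul_le_iff₀ (by positivity)]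
      simp only [inner_add_right, inner_sub_right, inner_sub_left, inner_smul_right] at *
      linarith
    · simp only
      rw [smul_smul, mul_inv_cancel₀ (by positivity), one_smul]
    · simp
  calc _ ≤ volume (b +ᵥ ((2 * m) • polarAt S c)) := measure_mono key
    _ = _ := by rw [measure_vadd, vol_smul, abs_of_pos (by positivity)]

lemma vol_half {n : ℕ} (S : Set (EE n)) (c : EE n) :
    volume (AffineMap.homothety c (1 / 2 : ℝ) '' S) = ENNReal.ofReal ((1 / 2) ^ n) * volume S := by
  rw [Measure.addHaar_image_homothety, finrank_euclideanSpace_fin, abs_of_pos (by positivity)]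

/-- The final arithmetic. -/
lemma final_arith (n N : ℕ) (lam Lam h m : ℝ) (V Q s : ℝ≥0∞) (hlam : 0 < lam)
    (hLam : 0 < Lam) (hh : 0 < h) (hm : m ≤ 2 * h) (hm0 : 0 < m) (hN : 0 < N)
    (hs0 : s ≠ 0) (hs : s ≠ ⊤)
    (h1 : (N : ℝ≥0∞) * (ENNReal.ofReal ((1 / 4) ^ n) * V) ≤ Q)
    (h2 : ENNReal.ofReal (h ^ n) * Q ≤ ENNReal.ofReal Lam * s)
    (h3 : ENNReal.ofReal lam * (ENNReal.ofReal ((1 / 2) ^ n) * s) ≤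
      ENNReal.ofReal ((2 * m) ^ n) * V) :
    lam * N ≤ Lam * 32 ^ n := by
  have hhn : 0 < h ^ n := by positivity
  have hQ : Q ≠ ⊤ := by
    rintro rfl
    rw [ENNReal.mul_top (by simpa using hhn)] at h2
    exact (ENNReal.mul_lt_top ENNReal.ofReal_lt_top hs.lt_top).not_ge h2
  have hV : V ≠ ⊤ := by
    rintro rfl
    rw [ENNReal.mul_top (by simp), ENNReal.mul_top (by simpa using hN.ne')] at h1
    exact hQ (top_le_iff.1 h1)
  have hV0 : V ≠ 0 := by
    rintro rfl
    simp only [mul_zero, nonpos_iff_eq_zero, mul_eq_zero, ENNReal.ofReal_eq_zero] at h3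
    rcases h3 with h3 | h3 | h3
    · linarith
    · have : (0 : ℝ) < (1 / 2) ^ n := by positivity
      linarith
    · exact hs0 h3
  lift V to NNReal using hV
  lift Q to NNReal using hQ
  lift s to NNReal using hs
  have e1 : (N : ℝ) * ((1 / 4) ^ n * V) ≤ Q := by
    have := ENNReal.toReal_mono (by simp) h1
    simpa [ENNReal.toReal_mul] using this
  have e2 : h ^ n * Q ≤ Lam * s := by
    have := ENNReal.toReal_mono (ENNReal.mul_ne_top (by simp) (by simp)) h2
    simpa only [ENNReal.toReal_mul, ENNReal.toReal_ofReal hhn.le, ENNReal.toReal_ofReal hLam.le,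
      ENNReal.coe_toReal] using this
  have e3 : lam * ((1 / 2) ^ n * s) ≤ (2 * m) ^ n * V := by
    have := ENNReal.toReal_mono (ENNReal.mul_ne_top (by simp) (by simp)) h3
    rwa [ENNReal.toReal_mul, ENNReal.toReal_mul, ENNReal.toReal_mul,
      ENNReal.toReal_ofReal hlam.le, ENNReal.toReal_ofReal (by positivity),
      ENNReal.toReal_ofReal (by positivity)] at this
  have hVp : (0 : ℝ) < V := by
    have : V ≠ 0 := by simpa using hV0
    exact_mod_cast pos_iff_ne_zero.2 this
  have e4 : (2 * m) ^ n ≤ 4 ^ n * h ^ n := by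
    rw [← mul_pow]; exact pow_le_pow_left₀ (by positivity) (by linarith) n
  have e5 : (32 : ℝ) ^ n = 4 ^ n * 4 ^ n * 2 ^ n := by
    rw [← mul_pow, ← mul_pow]; norm_num
  have i4 : (4 : ℝ) ^ n * (1 / 4) ^ n = 1 := by rw [← mul_pow]; norm_num
  have i2 : (2 : ℝ) ^ n * (1 / 2) ^ n = 1 := by rw [← mul_pow]; norm_num
  have hpos : 0 < h ^ n * (V : ℝ) := by positivity
  refine le_of_mul_le_mul_right ?_ hpos
  calc lam * N * (h ^ n * V)
      = lam * 4 ^ n * h ^ n * (N * ((1 / 4) ^ n * V)) := by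
        linear_combination (-(lam * N * h ^ n * V)) * i4
    _ ≤ lam * 4 ^ n * h ^ n * Q := by gcongr
    _ = lam * 4 ^ n * (h ^ n * Q) := by ring
    _ ≤ lam * 4 ^ n * (Lam * s) := by gcongr
    _ = Lam * 4 ^ n * 2 ^ n * (lam * ((1 / 2) ^ n * s)) := by
        linear_combination (-(lam * 4 ^ n * Lam * s)) * i2
    _ ≤ Lam * 4 ^ n * 2 ^ n * ((2 * m) ^ n * V) := by gcongr
    _ ≤ Lam * 4 ^ n * 2 ^ n * (4 ^ n * h ^ n * V) := by gcongr
    _ = Lam * 32 ^ n * (h ^ n * V) := by rw [e5]; ring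

/-- Lemma 2.13 (Caffarelli's strict convexity localization): the contact set of a
supporting hyperplane of a solution of `λ ≤ det D²u ≤ Λ` is either the single
point of contact, or it has no extreme point in the interior of the domain. -/
theorem stmt8 (n : ℕ) (lam Lam : ℝ) (hlam : 0 < lam) (hLam : lam ≤ Lam)
    (Ω : Set (EuclideanSpace ℝ (Fin n))) (u : EuclideanSpace ℝ (Fin n) → ℝ)
    (hΩo : IsOpen Ω) (hΩc : Convex ℝ Ω) (hΩb : Bornology.IsBounded Ω) (hne : Ω.Nonempty)
    (hcvx : ConvexOn ℝ (closure Ω) u) (hcont : ContinuousOn u (closure Ω))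
    (hMA : ∀ A : Set (EuclideanSpace ℝ (Fin n)), MeasurableSet A →
      ENNReal.ofReal lam * volume (A ∩ Ω) ≤ maMeasure Ω u A ∧
        maMeasure Ω u A ≤ ENNReal.ofReal Lam * volume (A ∩ Ω))
    (x : EuclideanSpace ℝ (Fin n)) (hx : x ∈ Ω)
    (p : EuclideanSpace ℝ (Fin n)) (hp : p ∈ subDiff (closure Ω) u x) :
    {y ∈ closure Ω | u y = u x + ⟪p, y - x⟫} = {x} ∨
      Set.extremePoints ℝ {y ∈ closure Ω | u y = u x + ⟪p, y - x⟫} ∩ Ω = ∅ := by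
  by_contra hcon
  push Not at hcon
  obtain ⟨hKx, x₀, hx₀, hx₀Ω⟩ := hcon
  set K : Set (EE n) := {y ∈ closure Ω | u y = u x + ⟪p, y - x⟫} with hK
  have hcomp : IsCompact (closure Ω) := hΩb.isCompact_closure
  have hconv : Convex ℝ (closure Ω) := hcvx.1
  have hxK : x ∈ K := ⟨subset_closure hx, by simp⟩
  -- the normalized function
  set w : EE n → ℝ := fun y => u y - ⟪p, y⟫ - (u x - ⟪p, x⟫) with hw
  have hwc : ContinuousOn w (closure Ω) :=
    (hcont.sub (by fun_prop)).sub continuousOn_const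
  have hw0 : ∀ y ∈ closure Ω, 0 ≤ w y := by
    intro y hy
    have := hp y hy
    rw [inner_sub_right] at this
    simp only [hw]; linarith
  have hKw : ∀ y, y ∈ K ↔ y ∈ closure Ω ∧ w y = 0 := by
    intro y
    simp only [hK, Set.mem_ofPred_eq, hw, inner_sub_right]
    constructor <;> rintro ⟨h1, h2⟩ <;> exact ⟨h1, by linarith⟩
  have hwcvx : ∀ y₁ ∈ closure Ω, ∀ y₂ ∈ closure Ω, ∀ α β : ℝ, 0 ≤ α → 0 ≤ β → α + β = 1 →
      w (α • y₁ + β • y₂) ≤ α * w y₁ + β * w y₂ := by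
    intro y₁ h1 y₂ h2 α β hα hβ hαβ
    have := hcvx.2 h1 h2 hα hβ hαβ
    simp only [hw, inner_add_right, inner_smul_right, smul_eq_mul] at *
    have hα' : α = 1 - β := by linarith
    subst hα'
    linarith
  have hKcomp : IsCompact K := by
    have : K = closure Ω ∩ w ⁻¹' {0} := by ext y; exact hKw y
    rw [this]
    exact hcomp.of_isClosed_subset (hwc.preimage_isClosed_of_isClosed isClosed_closure
      isClosed_singleton) Set.inter_subset_left
  have hKconv : Convex ℝ K := by
    intro y₁ h1 y₂ h2 α β hα hβ hαβ
    rw [hKw] at *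
    have hmem := hconv h1.1 h2.1 hα hβ hαβ
    refine ⟨hmem, le_antisymm ?_ (hw0 _ hmem)⟩
    have := hwcvx _ h1.1 _ h2.1 α β hα hβ hαβ
    simpa [h1.2, h2.2] using this
  have hKne : K ≠ {x₀} := by
    intro h
    apply hKx
    rw [h] at hxK
    rw [h, Set.mem_singleton_iff.1 hxK]
  obtain ⟨a, s, hsx₀, hslice, y₀, hy₀K, hy₀s⟩ :=
    exists_slice K Ω x₀ hKcomp hKconv hΩo hx₀ hx₀Ω hKne
  obtain ⟨z, hzK, hzmax⟩ := hKcomp.exists_isMaxOn ⟨x, hxK⟩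
    (f := fun y => (⟪a, y⟫ : ℝ)) (by fun_prop)
  have hzmax' : ∀ y ∈ K, (⟪a, y⟫ : ℝ) ≤ ⟪a, z⟫ := fun y hy => hzmax hy
  set L : ℝ := ⟪a, z⟫ - s with hLdef
  have hL : 0 < L := by have := hzmax' x₀ hx₀.1; linarith
  have hLam0 : 0 < Lam := hlam.trans_le hLam
  obtain ⟨N, hNbig⟩ := exists_nat_gt (Lam * 32 ^ n / lam)
  have hN0r : (0 : ℝ) < N := lt_of_le_of_lt (by positivity) hNbig
  have hN0 : 0 < N := by exact_mod_cast hN0r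
  have hN1 : (1 : ℝ) ≤ N := by exact_mod_cast hN0
  set η : ℝ := L / (4 * N) with hη
  have hη0 : 0 < η := by positivity
  have hηN : N * (4 * η) ≤ L := by
    rw [hη]; apply le_of_eq; field_simp
  have hηL : η ≤ L := by nlinarith
  -- choice of ε
  obtain ⟨M, hM⟩ := hcomp.bddAbove_image (f := fun y => (⟪a, y⟫ : ℝ) - s) (by fun_prop)
  have hM' : ∀ y ∈ closure Ω, (⟪a, y⟫ : ℝ) - s ≤ M := fun y hy => hM ⟨y, hy, rfl⟩
  obtain ⟨ε, hε, hεΩ⟩ : ∃ ε : ℝ, 0 < ε ∧ ∀ y ∈ closure Ω, w y ≤ ε * (⟪a, y⟫ - s) →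
      y ∈ Ω ∧ (⟪a, y⟫ : ℝ) < ⟪a, z⟫ + η := by
    set T : Set (EE n) := (closure Ω ∩ {y | s ≤ ⟪a, y⟫}) \
      (Ω ∩ {y | (⟪a, y⟫ : ℝ) < ⟪a, z⟫ + η}) with hT
    have hTc : IsCompact T := by
      refine (hcomp.inter_right (isClosed_le (by fun_prop) (by fun_prop))).diff
        (hΩo.inter (isOpen_lt (by fun_prop) (by fun_prop)))
    have hTpos : ∀ y ∈ T, 0 < w y := by
      rintro y ⟨⟨h1, h2⟩, h3⟩
      refine lt_of_le_of_ne (hw0 y h1) fun h => h3 ?_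
      have hyK : y ∈ K := (hKw y).2 ⟨h1, h.symm⟩
      refine ⟨hslice y hyK h2, ?_⟩
      have := hzmax' y hyK
      simp only [Set.mem_ofPred_eq]; linarith
    have hfin : ∀ μ : ℝ, 0 < μ → (∀ y ∈ T, μ ≤ w y) → ∃ ε : ℝ, 0 < ε ∧ ∀ y ∈ closure Ω,
        w y ≤ ε * (⟪a, y⟫ - s) → y ∈ Ω ∧ (⟪a, y⟫ : ℝ) < ⟪a, z⟫ + η := by
      intro μ hμ hTμ
      have hM1 : 0 < |M| + 1 := by positivity
      refine ⟨μ / (2 * (|M| + 1)), by positivity, fun y hy hwy => ?_⟩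
      have hpos : 0 < μ / (2 * (|M| + 1)) := by positivity
      by_contra hnot
      have hs' : s ≤ ⟪a, y⟫ := by
        have h1 := (hw0 y hy).trans hwy
        have := nonneg_of_mul_nonneg_right h1 hpos
        linarith
      have h2 := hTμ y ⟨⟨hy, hs'⟩, hnot⟩
      have h3 : (⟪a, y⟫ : ℝ) - s ≤ |M| + 1 := by
        linarith [hM' y hy, le_abs_self M]
      have h4 : μ / (2 * (|M| + 1)) * (⟪a, y⟫ - s) ≤ μ / (2 * (|M| + 1)) * (|M| + 1) := by
        gcongr
      have h5 : μ / (2 * (|M| + 1)) * (|M| + 1) = μ / 2 := by field_simp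
      linarith
    rcases T.eq_empty_or_nonempty with hTe | hTn
    · exact hfin 1 one_pos (by simp [hTe])
    · obtain ⟨y₁, hy₁, hmin⟩ := hTc.exists_isMinOn hTn (hwc.mono (fun y hy => hy.1.1))
      exact hfin (w y₁) (hTpos y₁ hy₁) (fun y hy => hmin hy)
  -- the section
  set b : EE n := p + ε • a with hb
  set k : ℝ := u x - ⟪p, x⟫ - ε * s with hk
  have hv : ∀ y, u y - ⟪b, y⟫ - k = w y - ε * (⟪a, y⟫ - s) := by
    intro y
    simp only [hb, hk, hw, inner_add_left, real_inner_smul_left]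
    ring
  set S : Set (EE n) := {y ∈ closure Ω | u y - ⟪b, y⟫ - k ≤ 0} with hS
  have hSmem : ∀ y, y ∈ S ↔ y ∈ closure Ω ∧ w y ≤ ε * (⟪a, y⟫ - s) := by
    intro y
    simp only [hS, Set.mem_ofPred_eq, hv, sub_nonpos]
  have hSΩ : S ⊆ Ω := fun y hy => (hεΩ y ((hSmem y).1 hy).1 ((hSmem y).1 hy).2).1
  have hSη : ∀ y ∈ S, (⟪a, y⟫ : ℝ) - ⟪a, z⟫ ≤ η := fun y hy => by
    linarith [(hεΩ y ((hSmem y).1 hy).1 ((hSmem y).1 hy).2).2]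
  have hvc : ContinuousOn (fun y => u y - ⟪b, y⟫ - k) (closure Ω) :=
    (hcont.sub (by fun_prop)).sub continuousOn_const
  have hSclosed : IsClosed S := by
    have : S = closure Ω ∩ (fun y => u y - ⟪b, y⟫ - k) ⁻¹' Set.Iic 0 := by
      ext y; rfl
    rw [this]
    exact hvc.preimage_isClosed_of_isClosed isClosed_closure isClosed_Iic
  have hSconv : Convex ℝ S := by
    intro y₁ h1 y₂ h2 α β hα hβ hαβ
    rw [hSmem] at *
    refine ⟨hconv h1.1 h2.1 hα hβ hαβ, (hwcvx _ h1.1 _ h2.1 α β hα hβ hαβ).trans ?_⟩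
    have e1 := mul_le_mul_of_nonneg_left h1.2 hα
    have e2 := mul_le_mul_of_nonneg_left h2.2 hβ
    simp only [inner_add_right, inner_smul_right]
    have hα' : α = 1 - β := by linarith
    subst hα'
    linarith
  have hzK' := (hKw z).1 hzK
  have hyK' := (hKw y₀).1 hy₀K
  have hzS : z ∈ S := (hSmem z).2 ⟨hzK'.1, by rw [hzK'.2]; positivity⟩
  have hyS : y₀ ∈ S := (hSmem y₀).2 ⟨hyK'.1, by rw [hyK'.2, hy₀s]; simp⟩
  set c : EE n := (1 / 2 : ℝ) • z + (1 / 2 : ℝ) • y₀ with hc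
  have hcS : c ∈ S := hSconv hzS hyS (by norm_num) (by norm_num) (by norm_num)
  have hcK : c ∈ K := hKconv hzK hy₀K (by norm_num) (by norm_num) (by norm_num)
  have hvc_neg : u c - ⟪b, c⟫ - k < 0 := by
    rw [hv, ((hKw c).1 hcK).2, hc, inner_add_right, inner_smul_right, inner_smul_right, hy₀s]
    have : 0 < ε * L := by positivity
    rw [hLdef] at this
    linarith
  have hSvol0 : volume S ≠ 0 := by
    have hnh : closure Ω ∈ nhds c := Filter.mem_of_superset (hΩo.mem_nhds (hSΩ hcS)) subset_closure
    have hSn : S ∈ nhds c := by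
      filter_upwards [hnh, (hvc.continuousAt hnh).eventually_lt_const hvc_neg] with y h1 h2
      exact ⟨h1, h2.le⟩
    exact (Measure.measure_pos_of_mem_nhds volume hSn).ne'
  have hSvol : volume S ≠ ⊤ := ((hΩb.subset hSΩ).measure_lt_top).ne
  have hh : 0 < ε * L := by positivity
  have hm : 0 < ε * (L + η) := by positivity
  have h1 := polar_compare S z y₀ a c L η N hzS hyS hc (by rw [hy₀s]) hL hη0 hηN hSη
  have h2 := (ma_ge_polar Ω u hΩb hcvx hcont b z k (ε * L) S hS hSΩ hzS hh
    (by rw [hv, hzK'.2]; ring)).trans (hMA S hSclosed.measurableSet).2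
  rw [Set.inter_eq_left.2 hSΩ] at h2
  have hhalf : AffineMap.homothety c (1 / 2 : ℝ) '' S ⊆ S := by
    rintro _ ⟨y, hy, rfl⟩
    have hhom : AffineMap.homothety c (1 / 2 : ℝ) y = (1 / 2 : ℝ) • c + (1 / 2 : ℝ) • y := by
      rw [AffineMap.homothety_apply]
      simp only [vsub_eq_sub, vadd_eq_add]
      module
    rw [hhom]
    exact hSconv hcS hy (by norm_num) (by norm_num) (by norm_num)
  have hScomp : IsCompact S := hcomp.of_isClosed_subset hSclosed (fun y hy => hy.1)
  have hhalfm : MeasurableSet (AffineMap.homothety c (1 / 2 : ℝ) '' S) :=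
    (hScomp.image (AffineMap.homothety_continuous c (1 / 2 : ℝ))).measurableSet
  have h3 := (hMA _ hhalfm).1.trans (ma_le_polar Ω u b c k (ε * (L + η)) S hSconv
    (fun y hy => hy.2) hSΩ hm (fun y hy => by
      rw [hv]
      have e1 := hw0 y hy.1
      have e2 := mul_le_mul_of_nonneg_left (hSη y hy) hε.le
      rw [hLdef]
      linarith) hcS)
  rw [Set.inter_eq_left.2 (hhalf.trans hSΩ), vol_half] at h3
  have hfinal := final_arith n N lam Lam (ε * L) (ε * (L + η)) _ _ _ hlam hLam0 hh
    (by nlinarith) hm hN0 hSvol0 hSvol h1 h2 h3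
  rw [div_lt_iff₀ hlam] at hNbig
  linarith
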